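/- Let f : {0,1}^n → {0,1} be a non-constant symmetric Boolean function and let p be a degree-d multilinear polynomial with 0 ≤ p(x) ≤ 1 for all x, p(x) ≥ 1/2 + β when f(x)=1 and p(x) ≤ 1/2 − β when f(x)=0, where β > 0. Then d ≥ √(2βn/(2β + 1)). -/

import Mathlib

open Polynomial in
theorem natDegree_lt_iff_deg {P : ℝ[X]} {n : ℕ} (hn : n ≠ 0) :
    P.natDegree < n ↔ P.degree < n := by
  by_cases h : P = 0
  · subst h; simp; omega
  · exact natDegree_lt_iff_degree_lt h

open Polynomial Polynomial.Chebyshev in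
theorem schur_core (n : ℕ) (hn : n ≠ 0) (R : ℝ[X]) (hR : R.degree < n)
    (hb : ∀ θ : ℝ, |R.eval (Real.cos θ) * Real.sin θ| ≤ 1) (x : ℝ)
    (hx : Real.cos (Real.pi / (2 * n)) ≤ x) (hx1 : x ≤ 1) : |R.eval x| ≤ n := by
  have hn0 : (0:ℝ) < n := by positivity
  set th : ℕ → ℝ := fun k => (2 * (k:ℝ) + 1) * Real.pi / (2 * n) with hth
  set v : ℕ → ℝ := fun k => Real.cos (th k) with hv
  have hthpos : ∀ k, 0 < th k := fun k => by simp only [hth]; positivity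
  have hthlt : ∀ k, k < n → th k < Real.pi := fun k hk => by
    simp only [hth]
    rw [div_lt_iff₀ (by positivity), mul_comm Real.pi]
    have : (k:ℝ) + 1 ≤ n := by exact_mod_cast hk
    have := Real.pi_pos
    nlinarith
  have hinj : Set.InjOn v (Finset.range n) := by
    have := roots_T_real_nodup n
    exact (Finset.range n).nodup_map_iff_injOn.mp this
  have hsin : ∀ k, k < n → 0 < Real.sin (th k) := fun k hk =>
    Real.sin_pos_of_pos_of_lt_pi (hthpos k) (hthlt k hk)
  have hTfac : T ℝ n = C ((2:ℝ) ^ (n - 1)) * Lagrange.nodal (Finset.range n) v := by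
    have hr : (T ℝ n).roots = (Finset.range n).val.map v := by
      rw [roots_T_real, Finset.image_val]
      exact Multiset.dedup_eq_self.mpr (roots_T_real_nodup n)
    have h := C_leadingCoeff_mul_prod_multiset_X_sub_C (p := T ℝ n) (by
      rw [hr]; simp)
    rw [hr, leadingCoeff_T] at h
    rw [← h, Lagrange.nodal_eq]
    simp [Finset.prod]
  set c : ℝ := 2 ^ (n - 1) with hc
  have hc0 : 0 < c := by positivity
  have hnode : ∀ k, k < n →
      c * |∏ j ∈ (Finset.range n).erase k, (v k - v j)| * Real.sin (th k) = n := by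
    intro k hk
    have e1 : (derivative (T ℝ n)).eval (v k) =
        c * ∏ j ∈ (Finset.range n).erase k, (v k - v j) := by
      rw [hTfac, derivative_C_mul, eval_C_mul,
        Lagrange.eval_nodal_derivative_eval_node_eq (Finset.mem_range.mpr hk), Lagrange.eval_nodal]
    have e2 : (derivative (T ℝ n)).eval (v k) * Real.sin (th k) = n * (-1) ^ k := by
      rw [T_derivative_eq_U]
      have h3 := U_real_cos (th k) ((n:ℤ) - 1)
      have h4 : Real.sin ((((n:ℤ) - 1 : ℤ) + 1 : ℝ) * th k) = (-1) ^ k := by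
        have : ((((n:ℤ) - 1 : ℤ) + 1 : ℝ) * th k) = k * Real.pi + Real.pi / 2 := by
          push_cast
          simp only [hth]; field_simp; ring
        rw [this, Real.sin_add_pi_div_two, Real.cos_nat_mul_pi]
      rw [h4] at h3
      simp only [eval_mul, hv]
      rw [mul_assoc, h3]
      simp
    rw [e1] at e2
    have := congrArg abs e2
    rw [abs_mul, abs_mul, abs_mul, abs_of_pos hc0, abs_of_pos (hsin k hk)] at this
    simpa using this
  have hfac : ∀ j, j < n → 0 ≤ x - v j := by
    intro j hj
    have : v j ≤ Real.cos (Real.pi / (2 * n)) := by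
      apply Real.cos_le_cos_of_nonneg_of_le_pi (by positivity) (hthlt j hj).le
      simp only [hth]
      gcongr
      have := Real.pi_pos
      nlinarith [(Nat.cast_nonneg j : (0:ℝ) ≤ j)]
    linarith
  have hint := Lagrange.eq_interpolate hinj (f := R) (by simpa using hR)
  have hev : R.eval x = ∑ i ∈ Finset.range n,
      R.eval (v i) / (∏ j ∈ (Finset.range n).erase i, (v i - v j)) *
        ∏ j ∈ (Finset.range n).erase i, (x - v j) := by
    conv_lhs => rw [hint, Lagrange.interpolate_eq_sum]
    simp [eval_finsetSum, eval_prod]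
  have hTd : (derivative (T ℝ n)).eval x =
      ∑ i ∈ Finset.range n, c * ∏ j ∈ (Finset.range n).erase i, (x - v j) := by
    rw [hTfac, derivative_C_mul, eval_C_mul, Lagrange.derivative_nodal, eval_finsetSum,
      Finset.mul_sum]
    simp [Lagrange.eval_nodal]
  have hTd1 : (derivative (T ℝ n)).eval x ≤ n ^ 2 := by
    have hx0 : -1 ≤ x := (Real.neg_one_le_cos _).trans hx
    have := abs_iterate_derivative_T_real_le n 1 (x := x) (abs_le.mpr ⟨hx0, hx1⟩)
    simp only [Function.iterate_one, derivative_T_eval_one] at this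
    exact (le_abs_self _).trans (by simpa using this)
  have hsum : |R.eval x| ≤ ∑ i ∈ Finset.range n,
      (c * ∏ j ∈ (Finset.range n).erase i, (x - v j)) / n := by
    rw [hev]
    refine (Finset.abs_sum_le_sum_abs _ _).trans (Finset.sum_le_sum fun i hi => ?_)
    have hi' := Finset.mem_range.mp hi
    have hP : 0 ≤ ∏ j ∈ (Finset.range n).erase i, (x - v j) :=
      Finset.prod_nonneg fun j hj => hfac j (Finset.mem_range.mp (Finset.mem_of_mem_erase hj))
    rw [abs_mul, abs_div, abs_of_nonneg hP, mul_div_right_comm]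
    refine mul_le_mul_of_nonneg_right ?_ hP
    have h1 := hnode i hi'
    have h2 := hb (th i)
    have hs := hsin i hi'
    rw [abs_mul, abs_of_pos hs] at h2
    change |R.eval (v i)| * _ ≤ 1 at h2
    have hD : 0 < |∏ j ∈ (Finset.range n).erase i, (v i - v j)| := by
      rcases (abs_nonneg (∏ j ∈ (Finset.range n).erase i, (v i - v j))).lt_or_eq with h | h
      · exact h
      · rw [← h] at h1; simp at h1; exact absurd h1.symm (by exact_mod_cast hn)
    rw [div_le_div_iff₀ hD hn0, ← h1]
    calc _ = c * |∏ j ∈ (Finset.range n).erase i, (v i - v j)| *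
          (|R.eval (v i)| * Real.sin (th i)) := by ring
      _ ≤ c * |∏ j ∈ (Finset.range n).erase i, (v i - v j)| * 1 := by gcongr
      _ = _ := by ring
  rw [← Finset.sum_div, ← hTd] at hsum
  refine hsum.trans ?_
  rw [div_le_iff₀ hn0]
  nlinarith

open Polynomial in
theorem schur_ineq (n : ℕ) (hn : n ≠ 0) (R : ℝ[X]) (hR : R.degree < n)
    (hb : ∀ θ : ℝ, |R.eval (Real.cos θ) * Real.sin θ| ≤ 1) (x : ℝ)
    (hx0 : -1 ≤ x) (hx1 : x ≤ 1) : |R.eval x| ≤ n := by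
  have hn0 : (0:ℝ) < n := by positivity
  have hn1 : (1:ℝ) ≤ n := by exact_mod_cast Nat.one_le_iff_ne_zero.mpr hn
  have hpi := Real.pi_pos
  by_cases h1 : Real.cos (Real.pi / (2 * n)) ≤ x
  · exact schur_core n hn R hR hb x h1 hx1
  by_cases h2 : Real.cos (Real.pi / (2 * n)) ≤ -x
  · have := schur_core n hn (R.comp (-X)) (by
      rw [← natDegree_lt_iff_deg hn, natDegree_comp, natDegree_neg, natDegree_X,
        mul_one]
      rwa [natDegree_lt_iff_deg hn]) (by
      intro θ
      have := hb (θ + Real.pi)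
      rw [Real.cos_add_pi, Real.sin_add_pi, mul_neg, abs_neg] at this
      simpa using this) (-x) h2 (by linarith)
    simpa using this
  push Not at h1 h2
  have hle : Real.pi / (2 * n) ≤ Real.pi / 2 := by
    apply div_le_div_of_nonneg_left hpi.le (by norm_num); linarith
  have ht0 : 0 < Real.pi / (2 * n) := by positivity
  set t := Real.pi / (2 * n) with ht
  have hs : 1 / (n:ℝ) ≤ Real.sin t := by
    have := Real.mul_le_sin ht0.le hle
    calc _ = 2 / Real.pi * t := by rw [ht]; field_simp
      _ ≤ _ := this
  set a := Real.arccos x with ha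
  have hca : Real.cos a = x := Real.cos_arccos hx0 hx1
  have hsa0 : 0 ≤ Real.sin a := Real.sin_nonneg_of_nonneg_of_le_pi (Real.arccos_nonneg x)
    (Real.arccos_le_pi x)
  have hsa : 1 / (n:ℝ) ≤ Real.sin a := by
    refine hs.trans ?_
    apply (sq_le_sq₀ ((by positivity : (0:ℝ) ≤ 1 / n).trans hs) hsa0).mp
    rw [Real.sin_sq, Real.sin_sq, hca]
    nlinarith
  have := hb a
  rw [hca, abs_mul, abs_of_nonneg hsa0] at this
  have h3 : |R.eval x| * (1 / n) ≤ 1 :=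
    (mul_le_mul_of_nonneg_left hsa (abs_nonneg _)).trans this
  rw [mul_one_div, div_le_one hn0] at h3
  exact h3

open Polynomial in
theorem cos_shift_pow (a : ℝ) (k : ℕ) : ∃ A B : ℝ[X], A.degree < (k + 1 : ℕ) ∧ B.degree < k ∧
    ∀ θ : ℝ, Real.cos (a + θ) ^ k =
      A.eval (Real.cos θ) + Real.sin θ * B.eval (Real.cos θ) := by
  induction k with
  | zero => exact ⟨1, 0, by simp, by simp, by simp⟩
  | succ k ih =>
    obtain ⟨A, B, hA, hB, h⟩ := ih
    refine ⟨C (Real.cos a) * (X * A) - C (Real.sin a) * ((1 - X ^ 2) * B),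
      C (Real.cos a) * (X * B) - C (Real.sin a) * A, ?_, ?_, ?_⟩
    · by_cases hB0 : B = 0
      · subst hB0
        rw [mul_zero, mul_zero, sub_zero, ← natDegree_lt_iff_deg (by omega)]
        rw [← natDegree_lt_iff_deg (by omega)] at hA
        have : (C (Real.cos a) * (X * A)).natDegree ≤ 0 + (1 + A.natDegree) := by
          refine natDegree_mul_le_of_le (by simp) (natDegree_mul_le_of_le (by simp) le_rfl)
        omega
      · have hk : k ≠ 0 := by
          rintro rfl
          simp at hB; exact hB0 hB
        rw [← natDegree_lt_iff_deg (by omega)] at hA ⊢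
        rw [← natDegree_lt_iff_deg hk] at hB
        have h1 : (C (Real.cos a) * (X * A)).natDegree ≤ 0 + (1 + A.natDegree) := by
          refine natDegree_mul_le_of_le (by simp) (natDegree_mul_le_of_le (by simp) le_rfl)
        have h2 : (C (Real.sin a) * ((1 - X ^ 2) * B)).natDegree ≤ 0 + (2 + B.natDegree) := by
          refine natDegree_mul_le_of_le (by simp) (natDegree_mul_le_of_le (by compute_degree) le_rfl)
        have := natDegree_sub_le (C (Real.cos a) * (X * A)) (C (Real.sin a) * ((1 - X ^ 2) * B))
        omega
    · by_cases hB0 : B = 0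
      · subst hB0
        rw [mul_zero, mul_zero, zero_sub, degree_neg]
        refine lt_of_le_of_lt (degree_mul_le _ _) ?_
        exact lt_of_le_of_lt (add_le_add_left degree_C_le _) (by simpa using hA)
      · have hk : k ≠ 0 := by
          rintro rfl
          simp at hB; exact hB0 hB
        rw [← natDegree_lt_iff_deg (by omega)] at hA ⊢
        rw [← natDegree_lt_iff_deg hk] at hB
        have h1 : (C (Real.cos a) * (X * B)).natDegree ≤ 0 + (1 + B.natDegree) := by
          refine natDegree_mul_le_of_le (by simp) (natDegree_mul_le_of_le (by simp) le_rfl)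
        have h2 : (C (Real.sin a) * A).natDegree ≤ 0 + A.natDegree := by
          refine natDegree_mul_le_of_le (by simp) le_rfl
        have := natDegree_sub_le (C (Real.cos a) * (X * B)) (C (Real.sin a) * A)
        omega
    · intro θ
      rw [pow_succ, h θ, Real.cos_add]
      simp only [eval_sub, eval_mul, eval_C, eval_X, eval_pow, eval_one]
      have := Real.sin_sq θ
      linear_combination (-Real.sin a * eval (Real.cos θ) B) * this

open Polynomial in
theorem cos_shift (a : ℝ) (n : ℕ) (P : ℝ[X]) (hP : P.natDegree ≤ n) : ∃ A B : ℝ[X], B.degree < n ∧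
    ∀ θ : ℝ, P.eval (Real.cos (a + θ)) =
      A.eval (Real.cos θ) + Real.sin θ * B.eval (Real.cos θ) := by
  choose A B hA hB h using cos_shift_pow a
  refine ⟨∑ k ∈ Finset.range (n + 1), C (P.coeff k) * A k,
    ∑ k ∈ Finset.range (n + 1), C (P.coeff k) * B k, ?_, ?_⟩
  · rw [← mem_degreeLT]
    refine Submodule.sum_mem _ fun k hk => ?_
    rw [← smul_eq_C_mul]
    refine Submodule.smul_mem _ _ (mem_degreeLT.mpr ((hB k).trans_le ?_))
    exact_mod_cast Nat.lt_succ_iff.mp (Finset.mem_range.mp hk)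
  · intro θ
    rw [eval_eq_sum_range' (Nat.lt_succ_iff.mpr hP), eval_finsetSum, eval_finsetSum,
      Finset.mul_sum, ← Finset.sum_add_distrib]
    refine Finset.sum_congr rfl fun k _ => ?_
    rw [h, eval_C_mul, eval_C_mul]; ring

open Polynomial in
theorem bernstein_ineq (n : ℕ) (hn : n ≠ 0) (P : ℝ[X]) (hP : P.natDegree ≤ n)
    (hb : ∀ x, -1 ≤ x → x ≤ 1 → |P.eval x| ≤ 1) (a : ℝ) :
    |(derivative P).eval (Real.cos a) * Real.sin a| ≤ n := by
  obtain ⟨A, B, hB, h⟩ := cos_shift a n P hP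
  have hb' : ∀ θ, |P.eval (Real.cos θ)| ≤ 1 := fun θ =>
    hb _ (Real.neg_one_le_cos θ) (Real.cos_le_one θ)
  have key : ∀ θ, P.eval (Real.cos (a + θ)) - P.eval (Real.cos (a + -θ)) =
      2 * (B.eval (Real.cos θ) * Real.sin θ) := by
    intro θ
    rw [h, h, Real.cos_neg, Real.sin_neg]; ring
  have hS := schur_ineq n hn B hB (by
    intro θ
    have h1 := abs_le.mp (hb' (a + θ))
    have h2 := abs_le.mp (hb' (a + -θ))
    have := key θ
    rw [abs_le]
    constructor <;> linarith) 1 (by norm_num) le_rfl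
  have d1 : HasDerivAt (fun θ => P.eval (Real.cos (a + θ)) - P.eval (Real.cos (a + -θ)))
      ((derivative P).eval (Real.cos (a + 0)) * (-Real.sin (a + 0) * 1) -
        (derivative P).eval (Real.cos (a + -0)) * (-Real.sin (a + -0) * (-1))) 0 := by
    have i1 : HasDerivAt (fun θ : ℝ => a + θ) 1 0 := (hasDerivAt_id' (0:ℝ)).const_add a
    have i2 : HasDerivAt (fun θ : ℝ => a + -θ) (-1) 0 := (hasDerivAt_id' (0:ℝ)).neg.const_add a
    have j1 := (P.hasDerivAt (Real.cos (a + 0))).comp (0:ℝ)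
      ((Real.hasDerivAt_cos (a + 0)).comp (0:ℝ) i1)
    have j2 := (P.hasDerivAt (Real.cos (a + -0))).comp (0:ℝ)
      ((Real.hasDerivAt_cos (a + -0)).comp (0:ℝ) i2)
    exact j1.sub j2
  have d2 : HasDerivAt (fun θ => 2 * (B.eval (Real.cos θ) * Real.sin θ))
      (2 * ((derivative B).eval (Real.cos 0) * (-Real.sin 0) * Real.sin 0 +
        B.eval (Real.cos 0) * Real.cos 0)) 0 := by
    have j1 := (B.hasDerivAt (Real.cos 0)).comp (0:ℝ) (Real.hasDerivAt_cos 0)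
    exact (j1.mul (Real.hasDerivAt_sin 0)).const_mul 2
  have e := d1.unique (by rw [funext key]; exact d2)
  simp at e
  have : (derivative P).eval (Real.cos a) * Real.sin a = - B.eval 1 := by linarith
  rw [this, abs_neg]; exact hS

open Polynomial in
theorem markov_ineq (n : ℕ) (P : ℝ[X]) (hP : P.natDegree ≤ n)
    (hb : ∀ x, -1 ≤ x → x ≤ 1 → |P.eval x| ≤ 1) (x : ℝ) (hx0 : -1 ≤ x) (hx1 : x ≤ 1) :
    |(derivative P).eval x| ≤ n ^ 2 := by
  rcases eq_or_ne n 0 with rfl | hn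
  · rw [derivative_of_natDegree_zero (by omega)]; simp
  have hn0 : (0:ℝ) < n := by positivity
  have := schur_ineq n hn (C ((n:ℝ)⁻¹) * derivative P) (by
    rw [← natDegree_lt_iff_deg hn]
    have h1 := natDegree_derivative_le P
    have h2 := natDegree_C_mul_le ((n:ℝ)⁻¹) (derivative P)
    omega) (by
    intro θ
    have := bernstein_ineq n hn P hP hb θ
    rw [eval_C_mul, mul_assoc, abs_mul, abs_of_pos (by positivity), inv_mul_le_iff₀ hn0]
    simpa using this) x hx0 hx1
  rw [eval_C_mul, abs_mul, abs_of_pos (by positivity), inv_mul_le_iff₀ hn0] at this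
  rw [sq]; exact this

theorem card_supersets (n k : ℕ) (S : Finset (Fin n)) :
    k.choose S.card * n.choose k =
      n.choose S.card * ((Finset.powersetCard k Finset.univ).filter (fun T => S ⊆ T)).card := by
  by_cases hs : S.card ≤ k
  · rw [mul_comm, Nat.choose_mul hs]
    congr 1
    have : ((Finset.powersetCard k Finset.univ).filter (fun T => S ⊆ T)).card =
        (Finset.powersetCard (k - S.card) Sᶜ).card := by
      refine Finset.card_bij' (fun T _ => T \ S) (fun T _ => T ∪ S) ?_ ?_ ?_ ?_
      · intro T hT
        simp only [Finset.mem_filter, Finset.mem_powersetCard] at hT ⊢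
        refine ⟨fun i hi => by simp at hi ⊢; exact hi.2, ?_⟩
        rw [Finset.card_sdiff_of_subset hT.2, hT.1.2]
      · intro T hT
        simp only [Finset.mem_filter, Finset.mem_powersetCard] at hT ⊢
        refine ⟨⟨Finset.subset_univ _, ?_⟩, Finset.subset_union_right⟩
        rw [Finset.card_union_of_disjoint, hT.2]
        · omega
        · exact Finset.disjoint_left.mpr fun i hi => by simpa using hT.1 hi
      · intro T hT
        simp only [Finset.mem_filter] at hT
        exact Finset.sdiff_union_of_subset hT.2
      · intro T hT
        simp only [Finset.mem_powersetCard] at hT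
        rw [Finset.union_sdiff_right]
        refine Finset.sdiff_eq_self_of_disjoint ?_
        exact Finset.disjoint_left.mpr fun i hi => by simpa using hT.1 hi
    rw [this, Finset.card_powersetCard, Finset.card_compl, Fintype.card_fin]
  · rw [Nat.choose_eq_zero_of_lt (by omega), zero_mul, Finset.filter_false_of_mem]
    · simp
    · intro T hT hST
      have := Finset.card_le_card hST
      rw [(Finset.mem_powersetCard.mp hT).2] at this
      omega

open Polynomial in
theorem symmetrize (n d : ℕ) (p : MvPolynomial (Fin n) ℝ) (hdeg : p.totalDegree ≤ d) :
    ∃ q : ℝ[X], q.natDegree ≤ d ∧ ∀ k : ℕ,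
      q.eval (k:ℝ) * (n.choose k : ℝ) =
        ∑ T ∈ Finset.powersetCard k (Finset.univ : Finset (Fin n)),
          MvPolynomial.eval (fun i => if i ∈ T then (1:ℝ) else 0) p := by
  refine ⟨∑ m ∈ p.support, C (p.coeff m / (n.descFactorial m.support.card : ℝ)) *
    descPochhammer ℝ m.support.card, ?_, ?_⟩
  · refine natDegree_sum_le_of_forall_le _ _ fun m hm => ?_
    refine (natDegree_C_mul_le _ _).trans ?_
    rw [descPochhammer_natDegree]
    refine le_trans ?_ ((MvPolynomial.le_totalDegree hm).trans hdeg)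
    rw [Finsupp.sum, Finset.card_eq_sum_ones]
    exact Finset.sum_le_sum fun i hi =>
      Nat.one_le_iff_ne_zero.mpr (Finsupp.mem_support_iff.mp hi)
  · intro k
    simp_rw [MvPolynomial.eval_eq]
    rw [Finset.sum_comm, eval_finsetSum, Finset.sum_mul]
    refine Finset.sum_congr rfl fun m _ => ?_
    rw [← Finset.mul_sum]
    have h1 : ∀ T : Finset (Fin n), (∏ i ∈ m.support, (if i ∈ T then (1:ℝ) else 0) ^ m i) =
        if m.support ⊆ T then 1 else 0 := by
      intro T
      split_ifs with h
      · exact Finset.prod_eq_one fun i hi => by simp [h hi]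
      · obtain ⟨i, hi, hiT⟩ := Finset.not_subset.mp h
        exact Finset.prod_eq_zero hi (by simp [hiT, Finsupp.mem_support_iff.mp hi])
    simp_rw [h1]
    rw [Finset.sum_boole, eval_C_mul, descPochhammer_eval_eq_descFactorial,
      Nat.descFactorial_eq_factorial_mul_choose, Nat.descFactorial_eq_factorial_mul_choose]
    have h2 := card_supersets n k m.support
    have hs : m.support.card ≤ n := by simpa using Finset.card_le_univ m.support
    have h3 : (n.choose m.support.card : ℝ) ≠ 0 := by
      exact_mod_cast (Nat.choose_pos hs).ne'
    have h4 : ((m.support.card).factorial : ℝ) ≠ 0 := by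
      exact_mod_cast (Nat.factorial_pos _).ne'
    have h5 : (k.choose m.support.card : ℝ) * n.choose k = n.choose m.support.card *
      (((Finset.powersetCard k Finset.univ).filter (fun T => m.support ⊆ T)).card : ℝ) := by
      exact_mod_cast h2
    push_cast
    field_simp
    linear_combination (p.coeff m) * h5

open Polynomial in
theorem ehlich_zeller (n d : ℕ) (q : ℝ[X]) (hq : q.natDegree ≤ d) (hn : n ≠ 0)
    (h01 : ∀ k : ℕ, k ≤ n → 0 ≤ q.eval (k:ℝ) ∧ q.eval (k:ℝ) ≤ 1) (b : ℝ) (hb : 0 < b)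
    (y : ℝ) (hy0 : 0 ≤ y) (hyn : y ≤ n) (hy : b ≤ |(derivative q).eval y|) :
    b * n / (b + 1) ≤ d ^ 2 := by
  have hn0 : (0:ℝ) < n := by positivity
  obtain ⟨z, hz, hmax⟩ := (isCompact_Icc (a := (0:ℝ)) (b := n)).exists_isMaxOn
    ⟨y, hy0, hyn⟩ (f := fun x => |(derivative q).eval x|)
    ((derivative q).continuous.abs.continuousOn)
  set c := |(derivative q).eval z| with hc
  have hm : ∀ x ∈ Set.Icc (0:ℝ) n, |(derivative q).eval x| ≤ c := fun x hx => hmax hx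
  have hbc : b ≤ c := hy.trans (hm y ⟨hy0, hyn⟩)
  have hc0 : 0 < c := hb.trans_le hbc
  have hrange : ∀ x ∈ Set.Icc (0:ℝ) n, |q.eval x - 1 / 2| ≤ (1 + c) / 2 := by
    intro x hx
    have hnear : ∃ k : ℕ, k ≤ n ∧ |x - k| ≤ 1 / 2 := by
      have hr := abs_sub_round x
      have hr' := abs_le.mp hr
      have r0 : 0 ≤ round x := by
        have : (-1:ℝ) < round x := by linarith [hx.1]
        have : (-1:ℤ) < round x := by exact_mod_cast this
        omega
      have rn : round x ≤ n := by
        have : (round x : ℝ) < n + 1 := by linarith [hx.2]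
        have : round x < (n:ℤ) + 1 := by exact_mod_cast this
        omega
      refine ⟨(round x).toNat, by omega, ?_⟩
      have : (((round x).toNat : ℕ) : ℝ) = ((round x : ℤ) : ℝ) := by
        exact_mod_cast congrArg (Int.cast : ℤ → ℝ) (Int.toNat_of_nonneg r0)
      rw [this]; exact hr
    obtain ⟨k, hk, hxk⟩ := hnear
    have hmv := Convex.norm_image_sub_le_of_norm_deriv_le (f := fun x => q.eval x)
      (s := Set.Icc (0:ℝ) n) (C := c) (x := (k:ℝ)) (y := x)
      (fun x _ => q.differentiableAt) (fun x hx => by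
        rw [Polynomial.deriv, Real.norm_eq_abs]; exact hm x hx) (convex_Icc _ _)
      ⟨by positivity, by exact_mod_cast hk⟩ hx
    simp only [Real.norm_eq_abs] at hmv
    have h2 : c * |x - k| ≤ c * (1 / 2) := by gcongr
    have h3 := abs_le.mp (hmv.trans h2)
    have h4 := h01 k hk
    rw [abs_le]; constructor <;> linarith
  set P : ℝ[X] := C (2 / (1 + c)) * ((q - C (1 / 2)).comp (C ((n:ℝ) / 2) * (X + C 1))) with hP
  have hdegP : P.natDegree ≤ d := by
    refine (natDegree_C_mul_le _ _).trans ?_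
    rw [natDegree_comp, natDegree_sub_C, natDegree_C_mul (by positivity), natDegree_X_add_C,
      mul_one]
    exact hq
  have hPb : ∀ x, -1 ≤ x → x ≤ 1 → |P.eval x| ≤ 1 := by
    intro x h1 h2
    have := hrange ((n:ℝ) / 2 * (x + 1)) ⟨mul_nonneg (by positivity) (by linarith), by nlinarith⟩
    rw [hP, eval_C_mul, eval_comp, abs_mul, abs_of_pos (by positivity)]
    simp only [eval_sub, eval_mul, eval_add, eval_C, eval_X]
    calc _ ≤ 2 / (1 + c) * ((1 + c) / 2) := by gcongr
      _ = 1 := by field_simp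
  have hM := markov_ineq d P hdegP hPb (2 / n * z - 1) (by
      have : 0 ≤ 2 / (n:ℝ) * z := mul_nonneg (by positivity) hz.1
      linarith) (by
      have : 2 / (n:ℝ) * z ≤ 2 / n * n := mul_le_mul_of_nonneg_left hz.2 (by positivity)
      rw [div_mul_cancel₀ _ hn0.ne'] at this
      linarith)
  have hder : (derivative P).eval (2 / n * z - 1) =
      2 / (1 + c) * (n / 2) * (derivative q).eval z := by
    have harg : (n:ℝ) / 2 * (2 / n * z - 1 + 1) = z := by field_simp; ring
    rw [hP, derivative_C_mul, derivative_comp, eval_C_mul, eval_mul, eval_comp]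
    simp only [derivative_sub, derivative_C, sub_zero, derivative_C_mul, derivative_add,
      derivative_X, add_zero, mul_one, eval_mul, eval_add, eval_C, eval_X]
    rw [harg]; ring
  rw [hder, abs_mul, abs_of_pos (by positivity), ← hc] at hM
  refine le_trans ?_ hM
  rw [div_le_iff₀ (by positivity)]
  have : 2 / (1 + c) * (n / 2) * c * (b + 1) = n * (c * (b + 1)) / (1 + c) := by field_simp
  rw [this, le_div_iff₀ (by positivity)]
  nlinarith [mul_le_mul_of_nonneg_left hbc hn0.le]

theorem exists_jump (n : ℕ) (g : ℕ → Bool) (i j : ℕ) (hi : i ≤ n) (hj : j ≤ n)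
    (h : g i ≠ g j) : ∃ k, k < n ∧ g k ≠ g (k + 1) := by
  by_contra! hcon
  have : ∀ k, k ≤ n → g k = g 0 := by
    intro k
    induction k with
    | zero => simp
    | succ k ih => intro hk; rw [← hcon k (by omega)]; exact ih (by omega)
  exact h ((this i hi).trans (this j hj).symm)

open MvPolynomial

/-- For a non-constant symmetric Boolean function `f` approximated in the
unbounded-error sense with bias `β` by a degree-`d` polynomial taking values in
`[0,1]`, one has `d ≥ √(2βn/(2β+1))`. -/
theorem stmt8 (n d : ℕ) (f : (Fin n → Bool) → Bool)
    (hsym : ∀ x y : Fin n → Bool,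
      (Finset.univ.filter (fun i => x i = true)).card =
        (Finset.univ.filter (fun i => y i = true)).card → f x = f y)
    (hnc : ∃ x y : Fin n → Bool, f x ≠ f y)
    (β : ℝ) (hβ : 0 < β)
    (p : MvPolynomial (Fin n) ℝ) (hdeg : p.totalDegree ≤ d)
    (h01 : ∀ x : Fin n → Bool,
      0 ≤ eval (fun i => if x i then (1:ℝ) else 0) p ∧
      eval (fun i => if x i then (1:ℝ) else 0) p ≤ 1)
    (h1 : ∀ x : Fin n → Bool, f x = true →
      1/2 + β ≤ eval (fun i => if x i then (1:ℝ) else 0) p)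
    (h0 : ∀ x : Fin n → Bool, f x = false →
      eval (fun i => if x i then (1:ℝ) else 0) p ≤ 1/2 - β) :
    Real.sqrt (2 * β * n / (2 * β + 1)) ≤ (d : ℝ) := by
  obtain ⟨q, hq, hqe⟩ := symmetrize n d p hdeg
  -- lower and upper bounds on levels transfer to `q`
  have hlow : ∀ k, k ≤ n → ∀ c : ℝ, (∀ T : Finset (Fin n), T.card = k →
      c ≤ eval (fun i => if i ∈ T then (1:ℝ) else 0) p) → c ≤ q.eval (k:ℝ) := by
    intro k hk c hc
    have hpos : (0:ℝ) < n.choose k := by exact_mod_cast Nat.choose_pos hk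
    have h := Finset.card_nsmul_le_sum (Finset.powersetCard k (Finset.univ : Finset (Fin n)))
      (fun T => eval (fun i => if i ∈ T then (1:ℝ) else 0) p) c
      (fun T hT => hc T (Finset.mem_powersetCard.mp hT).2)
    rw [← hqe k, Finset.card_powersetCard, Finset.card_univ, Fintype.card_fin, nsmul_eq_mul,
      mul_comm] at h
    exact le_of_mul_le_mul_right h hpos
  have hupp : ∀ k, k ≤ n → ∀ c : ℝ, (∀ T : Finset (Fin n), T.card = k →
      eval (fun i => if i ∈ T then (1:ℝ) else 0) p ≤ c) → q.eval (k:ℝ) ≤ c := by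
    intro k hk c hc
    have hpos : (0:ℝ) < n.choose k := by exact_mod_cast Nat.choose_pos hk
    have h := Finset.sum_le_card_nsmul (Finset.powersetCard k (Finset.univ : Finset (Fin n)))
      (fun T => eval (fun i => if i ∈ T then (1:ℝ) else 0) p) c
      (fun T hT => hc T (Finset.mem_powersetCard.mp hT).2)
    rw [← hqe k, Finset.card_powersetCard, Finset.card_univ, Fintype.card_fin, nsmul_eq_mul,
      mul_comm (n.choose k : ℝ)] at h
    exact le_of_mul_le_mul_right h hpos
  let ind : Finset (Fin n) → Fin n → Bool := fun T i => decide (i ∈ T)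
  have hind : ∀ T : Finset (Fin n), (fun i => if ind T i then (1:ℝ) else 0) =
      fun i => if i ∈ T then (1:ℝ) else 0 := by
    intro T; funext i; simp [ind]
  have hindc : ∀ T : Finset (Fin n), (Finset.univ.filter (fun i => ind T i = true)).card = T.card := by
    intro T; simp [ind]
  let g : ℕ → Bool := fun k => f (fun i => decide ((i:ℕ) < k))
  have hgc : ∀ k, k ≤ n →
      (Finset.univ.filter (fun i : Fin n => decide ((i:ℕ) < k) = true)).card = k := by
    intro k hk
    simp [Fin.card_filter_val_lt, hk]
  have hg : ∀ x : Fin n → Bool, f x = g (Finset.univ.filter (fun i => x i = true)).card := by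
    intro x
    apply hsym
    refine (hgc _ ?_).symm
    simpa using Finset.card_le_univ (Finset.univ.filter (fun i => x i = true))
  have hgT : ∀ T : Finset (Fin n), f (ind T) = g T.card := by
    intro T; rw [hg, hindc]
  have q01 : ∀ k : ℕ, k ≤ n → 0 ≤ q.eval (k:ℝ) ∧ q.eval (k:ℝ) ≤ 1 := fun k hk =>
    ⟨hlow k hk 0 fun T _ => by rw [← hind]; exact (h01 _).1,
     hupp k hk 1 fun T _ => by rw [← hind]; exact (h01 _).2⟩
  have q1 : ∀ k, k ≤ n → g k = true → 1 / 2 + β ≤ q.eval (k:ℝ) := fun k hk hgk =>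
    hlow k hk _ fun T hT => by rw [← hind]; exact h1 _ (by rw [hgT, hT, hgk])
  have q0 : ∀ k, k ≤ n → g k = false → q.eval (k:ℝ) ≤ 1 / 2 - β := fun k hk hgk =>
    hupp k hk _ fun T hT => by rw [← hind]; exact h0 _ (by rw [hgT, hT, hgk])
  obtain ⟨x, y, hxy⟩ := hnc
  rw [hg x, hg y] at hxy
  obtain ⟨k, hk, hjump⟩ := exists_jump n g _ _
    (by simpa using Finset.card_le_univ (Finset.univ.filter (fun i => x i = true)))
    (by simpa using Finset.card_le_univ (Finset.univ.filter (fun i => y i = true))) hxy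
  have hdiff : 2 * β ≤ |q.eval ((k + 1 : ℕ) : ℝ) - q.eval (k:ℝ)| := by
    rw [le_abs]
    cases ha : g k <;> cases hb : g (k + 1)
    · rw [ha, hb] at hjump; exact absurd rfl hjump
    · left; linarith [q0 k (by omega) ha, q1 (k + 1) (by omega) hb]
    · right; linarith [q1 k (by omega) ha, q0 (k + 1) (by omega) hb]
    · rw [ha, hb] at hjump; exact absurd rfl hjump
  obtain ⟨z, hz, hzd⟩ := exists_deriv_eq_slope (fun t => q.eval t) (a := (k:ℝ))
    (b := ((k + 1 : ℕ) : ℝ)) (by push_cast; linarith) q.continuous.continuousOn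
    q.differentiable.differentiableOn
  have hkn : ((k + 1 : ℕ) : ℝ) ≤ n := by exact_mod_cast hk
  have hfin := ehlich_zeller n d q hq (by omega) q01 (2 * β) (by positivity) z
    ((Nat.cast_nonneg k).trans hz.1.le) (hz.2.le.trans hkn) (by
      rw [Polynomial.deriv] at hzd
      rw [hzd]
      push_cast at hdiff ⊢
      simpa using hdiff)
  exact Real.sqrt_le_iff.mpr ⟨by positivity, hfin⟩
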